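/- arXiv:2405.03812 — 3 statements merged into one kernel-verified Lean document; each statement's English description precedes it below -/
import Mathlib

section
/- (Serre) Let k be a field of arbitrary characteristic, V a finite-dimensional k-vector space, and G a finite subgroup of GL(V). If the invariant ring S(V*)^G is isomorphic as a k-algebra to a polynomial ring, then G is generated by pseudo-reflections. -/
open MvPolynomial Matrix

/-- The subalgebra of invariants of a group acting by `k`-algebra automorphisms, the action
being encoded by a homomorphism `ψ` into the group of `k`-algebra automorphisms. -/
def invariantSubalgebra {k A : Type*} [CommSemiring k] [Semiring A] [Algebra k A]
    {G : Type*} [Group G] (ψ : G →* (A ≃ₐ[k] A)) : Subalgebra k A where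
  carrier := {a | ∀ g : G, ψ g a = a}
  add_mem' := fun {a b} ha hb g => by rw [map_add, ha g, hb g]
  mul_mem' := fun {a b} ha hb g => by rw [_root_.map_mul, ha g, hb g]
  algebraMap_mem' := fun c g => (ψ g).commutes c

theorem Algebra.FormallySmooth.exists_ringHom_lift {A E B : Type*} [CommRing A] [CommRing E]
    [CommRing B] [Algebra A E] [Algebra.FormallySmooth A E] (j : A →+* B) (p : B →+* E)
    (hp : Function.Surjective p) (hker : IsNilpotent (RingHom.ker p))
    (hj : p.comp j = algebraMap A E) :
    ∃ σ : E →+* B, σ.comp (algebraMap A E) = j ∧ p.comp σ = RingHom.id E := by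
  let := j.toAlgebra
  let q : B →ₐ[A] E := { p with commutes' := fun a => RingHom.congr_fun hj a }
  let σ := Algebra.FormallySmooth.liftOfSurjective (AlgHom.id A E) q hp hker
  refine ⟨σ, RingHom.ext fun a => σ.commutes a, RingHom.ext fun x => ?_⟩
  exact Algebra.FormallySmooth.liftOfSurjective_apply (AlgHom.id A E) q hp hker x

theorem dvd_of_forall_prime_exists_dvd_mul {S : Type*} [CommRing S] [IsDomain S]
    [UniqueFactorizationMonoid S] {a b : S} (hb : b ≠ 0)
    (h : ∀ π : S, Prime π → ∃ s, ¬ π ∣ s ∧ b ∣ s * a) : b ∣ a := by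
  obtain ⟨b', a', c, hrel, rfl, rfl⟩ := UniqueFactorizationMonoid.exists_reduced_factors b hb a
  have hc : c ≠ 0 := left_ne_zero_of_mul hb
  have hb' : b' ≠ 0 := right_ne_zero_of_mul hb
  refine mul_dvd_mul_left c ?_
  by_cases hu : IsUnit b'
  · exact hu.dvd
  obtain ⟨π, hπ, hπb⟩ := WfDvdMonoid.exists_irreducible_factor hu hb'
  have hπ' := hπ.prime
  obtain ⟨s, hs, hdvd⟩ := h π hπ'
  have h1 : b' ∣ s * a' := by
    have : c * b' ∣ c * (s * a') := by convert hdvd using 1; ring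
    exact (mul_dvd_mul_iff_left hc).mp this
  rcases hπ'.dvd_or_dvd (hπb.trans h1) with h2 | h2
  · exact absurd h2 hs
  · exact absurd (hrel hπb h2) hπ'.not_isUnit

/-- A ring homomorphism whose values lie in the range of an injective one factors through it. -/
theorem RingHom.exists_comp_eq_of_forall_mem_range {T B B' : Type*} [CommRing T] [CommRing B]
    [CommRing B'] (ι : B' →+* B) (hι : Function.Injective ι) (σ : T →+* B)
    (h : ∀ t, ∃ b, ι b = σ t) : ∃ σ' : T →+* B', ι.comp σ' = σ := by
  choose f hf using h
  refine ⟨{ toFun := f, map_one' := ?_, map_mul' := ?_, map_zero' := ?_, map_add' := ?_ }, ?_⟩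
  · exact hι (by simp [hf])
  · exact fun x y => hι (by simp [hf])
  · exact hι (by simp [hf])
  · exact fun x y => hι (by simp [hf])
  · ext t; exact hf t

section Invariants

open Polynomial in
theorem Algebra.IsInvariant.exists_aeval_eq_zero {A S Γ : Type*} [CommRing A] [CommRing S]
    [DecidableEq S]
    [Algebra A S] [Group Γ] [Fintype Γ] [MulSemiringAction Γ S] [Algebra.IsInvariant A S Γ]
    (x : S) :
    ∃ F : A[X], aeval x F = 0 ∧
      aeval x (derivative F) = ∏ s ∈ (Finset.univ.image fun g : Γ => g • x).erase x, (x - s) := by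
  set O : Finset S := Finset.univ.image fun g : Γ => g • x with hO
  have hx : x ∈ O := Finset.mem_image.mpr ⟨1, Finset.mem_univ _, one_smul _ _⟩
  have hmap (g : Γ) : O.image (fun s => g • s) = O := by
    rw [hO, Finset.image_image]
    ext y
    simp only [Finset.mem_image, Finset.mem_univ, true_and, Function.comp_apply]
    constructor
    · rintro ⟨a, rfl⟩; exact ⟨g * a, mul_smul _ _ _⟩
    · rintro ⟨a, rfl⟩; exact ⟨g⁻¹ * a, by rw [smul_smul, mul_inv_cancel_left]⟩
  have hinv (g : Γ) : g • (∏ s ∈ O, (Polynomial.X - Polynomial.C s)) =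
      ∏ s ∈ O, (Polynomial.X - Polynomial.C s) := by
    conv_rhs => rw [← hmap g, Finset.prod_image fun a _ b _ h => smul_left_cancel g h]
    rw [Finset.smul_prod']
    simp [smul_sub]
  have hlift : (∏ s ∈ O, (Polynomial.X - Polynomial.C s)) ∈ Polynomial.lifts (algebraMap A S) :=
    (Polynomial.lifts_iff_coeff_lifts _).mpr fun n =>
      Algebra.IsInvariant.isInvariant (G := Γ) _ fun g => by rw [← Polynomial.coeff_smul, hinv]
  obtain ⟨F, hF⟩ := (Polynomial.mem_lifts _).mp hlift
  rw [← Finset.mul_prod_erase O _ hx] at hF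
  refine ⟨F, ?_, ?_⟩
  · rw [Polynomial.aeval_def, ← Polynomial.eval_map, hF]; simp
  · rw [Polynomial.aeval_def, ← Polynomial.eval_map, ← derivative_map, hF, derivative_mul]
    simp [Polynomial.eval_prod]

/-- Over an infinite image, finitely many nonzero polynomials have a common non-root. -/
theorem exists_forall_not_dvd_eval {A S ι : Type*} [CommRing A] [CommRing S] [Finite ι]
    [Algebra A S] {π : S} (hπ : Prime π)
    (hinf : (Set.range fun a : A => Ideal.Quotient.mk (Ideal.span {π}) (algebraMap A S a)).Infinite)
    (Q : ι → Polynomial S) (hQ : ∀ i, ∃ n, ¬ π ∣ (Q i).coeff n) :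
    ∃ a : A, ∀ i, ¬ π ∣ (Q i).eval (algebraMap A S a) := by
  cases nonempty_fintype ι
  have : (Ideal.span {π}).IsPrime := (Ideal.span_singleton_prime hπ.ne_zero).mpr hπ
  let q := Ideal.Quotient.mk (Ideal.span {π})
  have hq (s : S) : q s = 0 ↔ π ∣ s := by
    rw [Ideal.Quotient.eq_zero_iff_mem, Ideal.mem_span_singleton]
  by_contra! hcon
  have h0 : ∏ i, (Q i).map q = 0 := by
    refine Polynomial.eq_zero_of_infinite_isRoot _ (hinf.mono ?_)
    rintro _ ⟨a, rfl⟩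
    obtain ⟨i, hi⟩ := hcon a
    rw [Set.mem_ofPred_eq, Polynomial.IsRoot.def, Polynomial.eval_prod]
    refine Finset.prod_eq_zero (Finset.mem_univ i) ?_
    rw [Polynomial.eval_map, Polynomial.eval₂_hom]
    exact (hq _).mpr hi
  obtain ⟨i, -, hi⟩ := Finset.prod_eq_zero_iff.mp h0
  obtain ⟨n, hn⟩ := hQ i
  apply hn
  rw [← hq, ← Polynomial.coeff_map, hi, Polynomial.coeff_zero]

theorem exists_mem_forall_not_dvd_smul_sub {A S Γ : Type*} [CommRing A] [CommRing S]
    [Algebra A S] [Group Γ] [Finite Γ] [MulSemiringAction Γ S] [SMulCommClass Γ A S]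
    {H : Subgroup Γ} (T : Subalgebra A S) {π : S} (hπ : Prime π)
    (hinf : (Set.range fun a : A => Ideal.Quotient.mk (Ideal.span {π}) (algebraMap A S a)).Infinite)
    (hsep : ∀ g ∉ H, ∃ c ∈ T, ¬ π ∣ g • c - c) :
    ∃ θ ∈ T, ∀ g ∉ H, ¬ π ∣ g • θ - θ := by
  classical
  cases nonempty_fintype Γ
  choose! c hcT hc using hsep
  let e := Fintype.equivFin {g : Γ // g ∉ H}
  obtain ⟨a, ha⟩ := exists_forall_not_dvd_eval hπ hinf
    (fun g : {g : Γ // g ∉ H} => ∑ h : {g : Γ // g ∉ H},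
      Polynomial.C (g.1 • c h - c h) * Polynomial.X ^ (e h : ℕ)) fun g => by
        refine ⟨e g, ?_⟩
        rw [Polynomial.finsetSum_coeff, Finset.sum_eq_single g]
        · simpa only [Polynomial.coeff_C_mul, Polynomial.coeff_X_pow_self, mul_one] using hc g.1 g.2
        · intro h _ hne
          rw [Polynomial.coeff_C_mul_X_pow, if_neg]
          exact fun heq => hne (e.injective (Fin.ext heq.symm))
        · simp
  refine ⟨∑ h : {g : Γ // g ∉ H}, c h * algebraMap A S a ^ (e h : ℕ),
    sum_mem fun h _ => mul_mem (hcT _ h.2) (pow_mem (T.algebraMap_mem a) _), fun g hg => ?_⟩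
  convert ha ⟨g, hg⟩ using 1
  simp [Polynomial.eval_finsetSum, Finset.smul_sum, smul_mul', smul_pow', smul_algebraMap,
    sub_mul]

/-- The chain rule for an `A`-derivation modulo `T` and a polynomial with coefficients in `A`. -/
theorem map_aeval_sub_derivative_mul_mem_range {A T E : Type*} [CommRing A] [CommRing T]
    [CommRing E] [Algebra A T] [Algebra T E] (δ : T → E)
    (hadd : ∀ s t, δ (s + t) = δ s + δ t)
    (hmul : ∀ s t, δ (s * t) - (algebraMap T E s * δ t + algebraMap T E t * δ s) ∈
      (algebraMap T E).range)
    (halg : ∀ a, δ (algebraMap A T a) ∈ (algebraMap T E).range) (θ : T) (F : Polynomial A) :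
    δ (Polynomial.aeval θ F) - algebraMap T E (Polynomial.aeval θ F.derivative) * δ θ ∈
      (algebraMap T E).range := by
  induction F using Polynomial.induction_on with
  | C a => simpa using halg a
  | add p q hp hq =>
    convert add_mem hp hq using 1
    simp only [map_add, hadd]
    ring
  | monomial n a ih =>
    rw [pow_succ, ← mul_assoc]
    set P := Polynomial.C a * Polynomial.X ^ n
    have h1 := hmul (Polynomial.aeval θ P) θ
    have h2 : algebraMap T E θ * _ ∈ _ := mul_mem (⟨θ, rfl⟩ : _ ∈ (algebraMap T E).range) ih
    convert add_mem h1 h2 using 1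
    simp only [map_add, map_mul, Polynomial.derivative_mul, Polynomial.aeval_X,
      Polynomial.derivative_X, mul_one]
    ring

theorem derivation_mem_range {A S Γ E : Type*} [CommRing A] [CommRing S] [IsDomain S]
    [UniqueFactorizationMonoid S] [Algebra A S] [Group Γ] [Finite Γ] [MulSemiringAction Γ S]
    [SMulCommClass Γ A S] [Algebra.IsInvariant A S Γ] {H : Subgroup Γ} (T : Subalgebra A S)
    (hT : ∀ t, t ∈ T ↔ ∀ h ∈ H, h • t = t)
    (hinf : ∀ π : S, Prime π →
      (Set.range fun a : A => Ideal.Quotient.mk (Ideal.span {π}) (algebraMap A S a)).Infinite)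
    (hsep : ∀ π : S, Prime π → ∀ g ∉ H, ∃ c ∈ T, ¬ π ∣ g • c - c)
    [Field E] [Algebra T E] [IsFractionRing T E] (δ : T → E)
    (hadd : ∀ s t, δ (s + t) = δ s + δ t)
    (hmul : ∀ s t, δ (s * t) - (algebraMap T E s * δ t + algebraMap T E t * δ s) ∈
      (algebraMap T E).range)
    (halg : ∀ a, δ (algebraMap A T a) ∈ (algebraMap T E).range) (t : T) :
    δ t ∈ (algebraMap T E).range := by
  classical
  cases nonempty_fintype Γ
  have hgood (π : S) (hπ : Prime π) (θ : T) (hθ : ∀ g ∉ H, ¬ π ∣ g • (θ : S) - θ) :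
      ∃ s : T, ¬ π ∣ (s : S) ∧ algebraMap T E s * δ θ ∈ (algebraMap T E).range := by
    obtain ⟨F, hF0, hF⟩ := Algebra.IsInvariant.exists_aeval_eq_zero (A := A) (Γ := Γ) (θ : S)
    have hF0' : Polynomial.aeval θ F = 0 := by
      apply Subtype.ext; simpa using hF0
    refine ⟨Polynomial.aeval θ F.derivative, ?_, ?_⟩
    · rw [Polynomial.aeval_subalgebra_coe, hF, hπ.dvd_finsetProd_iff]
      rintro ⟨s, hs, hdvd⟩
      obtain ⟨hne, hs⟩ := Finset.mem_erase.mp hs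
      obtain ⟨g, -, rfl⟩ := Finset.mem_image.mp hs
      exact hθ g (fun hg => hne ((hT _).mp θ.2 g hg)) ((dvd_sub_comm).mp hdvd)
    · have h0 : δ 0 = 0 := by simpa using hadd 0 0
      have := map_aeval_sub_derivative_mul_mem_range δ hadd hmul halg θ F
      rw [hF0', h0, zero_sub] at this
      exact neg_mem_iff.mp this
  have hloc (π : S) (hπ : Prime π) :
      ∃ s : T, ¬ π ∣ (s : S) ∧ algebraMap T E s * δ t ∈ (algebraMap T E).range := by
    obtain ⟨θ, hθT, hθ⟩ := exists_mem_forall_not_dvd_smul_sub T hπ (hinf π hπ) (hsep π hπ)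
    obtain ⟨a, ha⟩ := exists_forall_not_dvd_eval hπ (hinf π hπ)
      (fun g : {g : Γ // g ∉ H} => Polynomial.C (g.1 • (t : S) - t) +
        Polynomial.C (g.1 • θ - θ) * Polynomial.X) fun g => ⟨1, by simpa using hθ g.1 g.2⟩
    set θ' : T := ⟨θ, hθT⟩
    obtain ⟨s₁, hs₁, h₁⟩ := hgood π hπ θ' hθ
    obtain ⟨s₂, hs₂, h₂⟩ := hgood π hπ (t + θ' * algebraMap A T a) fun g hg => by
      have := ha ⟨g, hg⟩
      rw [Polynomial.eval_add, Polynomial.eval_mul, Polynomial.eval_C, Polynomial.eval_C,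
        Polynomial.eval_X] at this
      convert this using 2
      simp only [θ', Subalgebra.coe_add, Subalgebra.coe_mul, Subalgebra.coe_algebraMap, smul_add,
        smul_mul', smul_algebraMap]
      ring
    refine ⟨s₁ * s₂, fun h => (hπ.dvd_or_dvd h).elim hs₁ hs₂, ?_⟩
    have hr (x : T) : algebraMap T E x ∈ (algebraMap T E).range := ⟨x, rfl⟩
    have h₃ := hmul θ' (algebraMap A T a)
    rw [hadd] at h₂
    convert sub_mem (sub_mem (sub_mem (mul_mem (hr s₁) h₂) (mul_mem (hr (s₁ * s₂)) h₃))
      (mul_mem (hr (s₂ * algebraMap A T a)) h₁))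
      (mul_mem (hr (s₁ * s₂ * θ')) (halg a)) using 1
    simp only [map_mul]
    ring
  obtain ⟨a, b, hb, hab⟩ := IsFractionRing.div_surjective (A := T) (δ t)
  have hb0 : b ≠ 0 := nonZeroDivisors.ne_zero hb
  have hbE : algebraMap T E b ≠ 0 := fun h =>
    hb0 (IsFractionRing.injective T E (h.trans (map_zero _).symm))
  have hdvd : (b : S) ∣ a := by
    refine dvd_of_forall_prime_exists_dvd_mul (by simpa using hb0) fun π hπ => ?_
    obtain ⟨s, hs, r, hr⟩ := hloc π hπ
    refine ⟨s, hs, (r : S), ?_⟩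
    rw [← hab, mul_div_assoc', eq_div_iff hbE, ← map_mul, ← map_mul] at hr
    have := congrArg (Subtype.val) (IsFractionRing.injective T E hr)
    simpa [mul_comm] using this.symm
  obtain ⟨c, hc⟩ := hdvd
  have hcT : c ∈ T := by
    refine (hT c).mpr fun h hh => ?_
    have h1 := (hT _).mp a.2 h hh
    rw [hc, smul_mul', (hT _).mp b.2 h hh] at h1
    exact mul_left_cancel₀ (by simpa using hb0) h1
  refine ⟨⟨c, hcT⟩, ?_⟩
  rw [← hab, eq_div_iff hbE, ← map_mul]
  congr 1
  apply Subtype.ext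
  simp [hc, mul_comm]

end Invariants

section Taylor

/-- Every `A`-derivation of `T` with values in `E / T` vanishes; `δ` is a lift of such a
derivation to a map into `E`. -/
def DerivationsModIntegral (A T E : Type*) [CommRing A] [CommRing T] [CommRing E] [Algebra A T]
    [Algebra T E] : Prop :=
  ∀ δ : T → E, (∀ s t, δ (s + t) = δ s + δ t) →
    (∀ s t, δ (s * t) - (algebraMap T E s * δ t + algebraMap T E t * δ s) ∈
      (algebraMap T E).range) →
    (∀ a, δ (algebraMap A T a) ∈ (algebraMap T E).range) → ∀ t, δ t ∈ (algebraMap T E).range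

theorem coeff_eq_of_mk_eq {τ E : Type*} [CommRing E] {N : ℕ} {p q : MvPolynomial τ E}
    (h : Ideal.Quotient.mk (idealOfVars τ E ^ N) p = Ideal.Quotient.mk _ q) {α : τ →₀ ℕ}
    (hα : Finsupp.degree α < N) : p.coeff α = q.coeff α := by
  have := (mem_pow_idealOfVars_iff' N _).mp (Ideal.Quotient.eq.mp h) α hα
  rwa [coeff_sub, sub_eq_zero] at this

theorem mk_eq_of_coeff_eq {τ E : Type*} [CommRing E] {N : ℕ} {p q : MvPolynomial τ E}
    (h : ∀ α, Finsupp.degree α < N → p.coeff α = q.coeff α) :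
    Ideal.Quotient.mk (idealOfVars τ E ^ N) p = Ideal.Quotient.mk _ q := by
  refine Ideal.Quotient.eq.mpr ((mem_pow_idealOfVars_iff' N _).mpr fun α hα => ?_)
  rw [coeff_sub, h α hα, sub_self]

/-- A truncated Taylor expansion with integral coefficients on `A` has integral coefficients on
all of `T`. -/
theorem DerivationsModIntegral.exists_mk_map_eq {τ A T E : Type*} [CommRing A] [CommRing T]
    [CommRing E] [Algebra A T] [Algebra T E] (hder : DerivationsModIntegral A T E) {N : ℕ}
    (σ : T →+* MvPolynomial τ E ⧸ idealOfVars τ E ^ N)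
    (hconst : ∀ t q, σ t = Ideal.Quotient.mk _ q → coeff 0 q = algebraMap T E t)
    (hA : ∀ a, ∃ p : MvPolynomial τ T,
      σ (algebraMap A T a) = Ideal.Quotient.mk _ (map (algebraMap T E) p)) (t : T) :
    ∃ p : MvPolynomial τ T, σ t = Ideal.Quotient.mk _ (map (algebraMap T E) p) := by
  classical
  choose q hq using fun t => Ideal.Quotient.mk_surjective (σ t)
  have key (d : ℕ) (hd : d < N) (α : τ →₀ ℕ) (hα : Finsupp.degree α = d) (t : T) :
      (q t).coeff α ∈ (algebraMap T E).range := by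
    induction d using Nat.strong_induction_on generalizing α t with
    | _ d ih =>
    by_cases h0 : α = 0
    · exact ⟨t, by rw [h0, hconst t (q t) (hq t).symm]⟩
    refine hder (fun t => (q t).coeff α) (fun s t => ?_) (fun s t => ?_) (fun a => ?_) t
    · rw [← coeff_add]
      exact coeff_eq_of_mk_eq (by rw [hq, map_add, map_add, hq, hq]) (hα ▸ hd)
    · have h1 : (q (s * t)).coeff α = (q s * q t).coeff α :=
        coeff_eq_of_mk_eq (by rw [hq, map_mul, map_mul, hq, hq]) (hα ▸ hd)
      have m1 : (0, α) ∈ Finset.HasAntidiagonal.antidiagonal α := by simp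
      have m2 : (α, 0) ∈ (Finset.HasAntidiagonal.antidiagonal α).erase (0, α) := by simp [h0]
      simp only [h1]
      rw [coeff_mul, ← Finset.add_sum_erase _ _ m1, ← Finset.add_sum_erase _ _ m2,
        hconst s (q s) (hq s).symm, hconst t (q t) (hq t).symm]
      have h2 : ∑ x ∈ ((Finset.HasAntidiagonal.antidiagonal α).erase (0, α)).erase (α, 0),
          (q s).coeff x.1 * (q t).coeff x.2 ∈ (algebraMap T E).range := by
        refine sum_mem fun x hx => ?_
        simp only [Finset.mem_erase, Finset.HasAntidiagonal.mem_antidiagonal, ne_eq] at hx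
        obtain ⟨hx1, hx2, hx3⟩ := hx
        have hdeg : Finsupp.degree x.1 + Finsupp.degree x.2 = d := by
          rw [← map_add, hx3, hα]
        have hx1' : Finsupp.degree x.2 ≠ 0 := fun h => by
          have h' := (Finsupp.degree_eq_zero_iff _).mp h
          exact hx1 (Prod.ext (by simpa [h'] using hx3) h')
        have hx2' : Finsupp.degree x.1 ≠ 0 := fun h => by
          have h' := (Finsupp.degree_eq_zero_iff _).mp h
          exact hx2 (Prod.ext h' (by simpa [h'] using hx3))
        exact mul_mem (ih _ (by omega) (by omega) _ rfl _) (ih _ (by omega) (by omega) _ rfl _)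
      convert h2 using 1
      ring
    · obtain ⟨p, hp⟩ := hA a
      exact ⟨p.coeff α, by rw [coeff_eq_of_mk_eq ((hq _).trans hp) (hα ▸ hd), coeff_map]⟩
  choose! c hc using fun (α : τ →₀ ℕ) (hα : Finsupp.degree α < N) => key _ hα α rfl t
  refine ⟨∑ α ∈ (q t).support with Finsupp.degree α < N, monomial α (c α), ?_⟩
  rw [← hq]
  refine mk_eq_of_coeff_eq fun α hα => ?_
  rw [coeff_map, coeff_sum]
  simp only [coeff_monomial, Finset.sum_ite_eq', Finset.mem_filter, mem_support_iff, hα, and_true]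
  split_ifs with h
  · exact (hc α hα).symm
  · rw [map_zero, not_not.mp h]

theorem exists_taylor_ringHom {k τ E : Type*} [CommRing k] [CommRing E]
    [Algebra (MvPolynomial τ k) E] [Algebra.FormallySmooth (MvPolynomial τ k) E]
    {N : ℕ} (hN : N ≠ 0) :
    ∃ σ : E →+* MvPolynomial τ E ⧸ idealOfVars τ E ^ N,
      (∀ c : k, σ (algebraMap (MvPolynomial τ k) E (C c)) =
        Ideal.Quotient.mk _ (C (algebraMap (MvPolynomial τ k) E (C c)))) ∧
      (∀ i, σ (algebraMap (MvPolynomial τ k) E (X i)) =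
        Ideal.Quotient.mk _ (C (algebraMap (MvPolynomial τ k) E (X i)) + X i)) ∧
      ∀ x q, σ x = Ideal.Quotient.mk _ q → coeff 0 q = x := by
  let j : MvPolynomial τ k →+* MvPolynomial τ E ⧸ idealOfVars τ E ^ N :=
    eval₂Hom ((Ideal.Quotient.mk _).comp (C.comp ((algebraMap (MvPolynomial τ k) E).comp C)))
      fun i => Ideal.Quotient.mk _ (C (algebraMap (MvPolynomial τ k) E (X i)) + X i)
  have hvars (q : MvPolynomial τ E) : constantCoeff q = 0 ↔ q ∈ idealOfVars τ E := by
    rw [← pow_one (idealOfVars τ E), mem_pow_idealOfVars_iff']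
    constructor
    · intro h α hα
      rw [Nat.lt_one_iff, Finsupp.degree_eq_zero_iff] at hα
      rwa [hα]
    · exact fun h => h 0 (by simp)
  let p : (MvPolynomial τ E ⧸ idealOfVars τ E ^ N) →+* E :=
    Ideal.Quotient.lift _ constantCoeff fun q hq => (hvars q).mpr (Ideal.pow_le_self hN hq)
  have hp (q) : p (Ideal.Quotient.mk _ q) = constantCoeff q := Ideal.Quotient.lift_mk _ _ _
  have hsurj : Function.Surjective p := fun x =>
    ⟨Ideal.Quotient.mk _ (C x), by rw [hp, constantCoeff_C]⟩
  have hker : RingHom.ker p ≤ (idealOfVars τ E).map (Ideal.Quotient.mk (idealOfVars τ E ^ N)) := by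
    intro x hx
    obtain ⟨q, rfl⟩ := Ideal.Quotient.mk_surjective x
    rw [RingHom.mem_ker, hp, hvars] at hx
    exact Ideal.mem_map_of_mem _ hx
  have hnil : IsNilpotent (RingHom.ker p) := by
    refine ⟨N, ?_⟩
    rw [Ideal.zero_eq_bot, eq_bot_iff]
    refine (Ideal.pow_right_mono hker N).trans ?_
    rw [← Ideal.map_pow, Ideal.map_quotient_self]
  have hj : p.comp j = algebraMap (MvPolynomial τ k) E := by
    refine MvPolynomial.ringHom_ext (fun c => ?_) fun i => ?_
    · simp [j, hp]
    · simp only [RingHom.comp_apply, j, coe_eval₂Hom, eval₂_X, hp]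
      simp
  obtain ⟨σ, hσ, hpσ⟩ := Algebra.FormallySmooth.exists_ringHom_lift j p hsurj hnil hj
  refine ⟨σ, fun c => ?_, fun i => ?_, fun x q hx => ?_⟩
  · rw [← RingHom.comp_apply, hσ]; simp [j]
  · rw [← RingHom.comp_apply, hσ]; simp only [j, coe_eval₂Hom, eval₂_X]
  · rw [← constantCoeff_eq, ← hp, ← hx, ← RingHom.comp_apply, hpσ, RingHom.id_apply]

/-- The Taylor expansion of the elements of `T`, evaluated at the point where all the coordinate
functions of `A` vanish. -/
theorem DerivationsModIntegral.exists_ringHom_quotient {k τ T E : Type*} [CommRing k] [CommRing T]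
    [CommRing E] [Algebra (MvPolynomial τ k) T] [Algebra (MvPolynomial τ k) E] [Algebra T E]
    [IsScalarTower (MvPolynomial τ k) T E] [Algebra.FormallySmooth (MvPolynomial τ k) E]
    (hinj : Function.Injective (algebraMap T E))
    (hder : DerivationsModIntegral (MvPolynomial τ k) T E) {N : ℕ} (hN : N ≠ 0) :
    ∃ φ : T →+* T ⧸ (idealOfVars τ k).map (algebraMap (MvPolynomial τ k) T) ^ N,
      (∀ a : MvPolynomial τ k, φ (algebraMap (MvPolynomial τ k) T a) =
        Ideal.Quotient.mk _ (algebraMap (MvPolynomial τ k) T (C (constantCoeff a)))) ∧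
      ∀ t, ∃ y, φ t = Ideal.Quotient.mk _ y ∧
        y - t ∈ (idealOfVars τ k).map (algebraMap (MvPolynomial τ k) T) := by
  obtain ⟨σ, hC, hX, hconst⟩ := exists_taylor_ringHom (k := k) (τ := τ) (E := E) hN
  let jT : MvPolynomial τ k →+* MvPolynomial τ T :=
    eval₂Hom (C.comp ((algebraMap (MvPolynomial τ k) T).comp C))
      fun i => C (algebraMap (MvPolynomial τ k) T (X i)) + X i
  have hj (a : MvPolynomial τ k) : (σ.comp (algebraMap T E)) (algebraMap (MvPolynomial τ k) T a) =
      Ideal.Quotient.mk _ (map (algebraMap T E) (jT a)) := by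
    have : (σ.comp (algebraMap T E)).comp (algebraMap (MvPolynomial τ k) T) =
        ((Ideal.Quotient.mk _).comp (map (algebraMap T E))).comp jT := by
      refine MvPolynomial.ringHom_ext (fun c => ?_) fun i => ?_
      · simp [jT, ← IsScalarTower.algebraMap_apply, hC]
      · simp only [RingHom.comp_apply, jT, coe_eval₂Hom, eval₂_X,
          ← IsScalarTower.algebraMap_apply, hX, map_add, map_C, map_X]
    exact RingHom.congr_fun this a
  have hint := hder.exists_mk_map_eq (σ.comp (algebraMap T E))
    (fun t q h => hconst _ q h) fun a => ⟨_, hj a⟩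
  have hle : idealOfVars τ T ^ N ≤ (idealOfVars τ E ^ N).comap (map (algebraMap T E)) := by
    intro p hp
    rw [mem_pow_idealOfVars_iff'] at hp
    rw [Ideal.mem_comap, mem_pow_idealOfVars_iff']
    intro α hα
    rw [coeff_map, hp α hα, map_zero]
  let ι := Ideal.quotientMap (idealOfVars τ E ^ N) (map (algebraMap T E)) hle
  have hι (p) : ι (Ideal.Quotient.mk _ p) = Ideal.Quotient.mk _ (map (algebraMap T E) p) :=
    Ideal.quotientMap_mk
  have hιinj : Function.Injective ι := by
    refine Ideal.quotientMap_injective' fun p hp => ?_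
    rw [Ideal.mem_comap, mem_pow_idealOfVars_iff'] at hp
    rw [mem_pow_idealOfVars_iff']
    intro α hα
    apply hinj
    rw [map_zero, ← coeff_map, hp α hα]
  obtain ⟨σ', hσ'⟩ := RingHom.exists_comp_eq_of_forall_mem_range ι hιinj
    (σ.comp (algebraMap T E)) fun t => by
      obtain ⟨p, hp⟩ := hint t
      exact ⟨Ideal.Quotient.mk _ p, by rw [hι, hp]⟩
  set 𝔪 := (idealOfVars τ k).map (algebraMap (MvPolynomial τ k) T)
  let ev : MvPolynomial τ T →+* T :=
    eval₂Hom (RingHom.id T) fun i => -algebraMap (MvPolynomial τ k) T (X i)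
  have hev : idealOfVars τ T ≤ 𝔪.comap ev := by
    rw [idealOfVars, Ideal.span_le]
    rintro _ ⟨i, rfl⟩
    simp only [ev, Ideal.coe_comap, Set.mem_preimage, coe_eval₂Hom, eval₂_X, SetLike.mem_coe,
      neg_mem_iff]
    exact Ideal.mem_map_of_mem _ (Ideal.subset_span ⟨i, rfl⟩)
  have hevN : idealOfVars τ T ^ N ≤ (𝔪 ^ N).comap ev :=
    (Ideal.pow_right_mono hev N).trans (Ideal.le_comap_pow ev N)
  refine ⟨(Ideal.quotientMap (𝔪 ^ N) ev hevN).comp σ', fun a => ?_, fun t => ?_⟩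
  · have h1 : σ' (algebraMap (MvPolynomial τ k) T a) = Ideal.Quotient.mk _ (jT a) := by
      apply hιinj
      rw [hι, ← hj, ← hσ', RingHom.comp_apply]
    have h2 : ev.comp jT = (algebraMap (MvPolynomial τ k) T).comp (C.comp constantCoeff) := by
      refine MvPolynomial.ringHom_ext (fun c => ?_) fun i => ?_
      · simp [jT, ev]
      · simp only [RingHom.comp_apply, jT, coe_eval₂Hom, eval₂_X, ev]
        simp
    rw [RingHom.comp_apply, h1, Ideal.quotientMap_mk, ← RingHom.comp_apply ev, h2]
    rfl
  · obtain ⟨p, hp⟩ := Ideal.Quotient.mk_surjective (σ' t)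
    refine ⟨ev p, by rw [RingHom.comp_apply, ← hp, Ideal.quotientMap_mk], ?_⟩
    have h1 : coeff 0 p = t := by
      apply hinj
      rw [← coeff_map]
      refine hconst _ _ ?_
      rw [← hι, hp, ← RingHom.comp_apply, ← hσ', RingHom.comp_apply]
    have h2 : p - C t ∈ idealOfVars τ T := by
      rw [← pow_one (idealOfVars τ T), mem_pow_idealOfVars_iff']
      intro α hα
      rw [Nat.lt_one_iff, Finsupp.degree_eq_zero_iff] at hα
      rw [hα, coeff_sub, h1, coeff_zero_C, sub_self]
    simpa [ev] using hev h2

end Taylor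

/-- The fraction field of an algebra between a domain and a finite Galois cover of it is
formally smooth over that domain. -/
theorem Algebra.IsInvariant.formallySmooth_fractionRing {A S : Type*} (Γ : Type*) [CommRing A]
    [IsDomain A] [CommRing S] [IsDomain S] [Algebra A S] [FaithfulSMul A S] [Group Γ] [Finite Γ]
    [MulSemiringAction Γ S] [Algebra.IsInvariant A S Γ] (T : Subalgebra A S) :
    Algebra.FormallySmooth A (FractionRing T) := by
  classical
  cases nonempty_fintype Γ
  let K := FractionRing A
  let E := FractionRing T
  have : FaithfulSMul A T := by
    rw [faithfulSMul_iff_algebraMap_injective]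
    intro a b hab
    exact FaithfulSMul.algebraMap_injective A S (congrArg Subtype.val hab)
  have : FaithfulSMul A E := by
    rw [faithfulSMul_iff_algebraMap_injective, IsScalarTower.algebraMap_eq A T E]
    exact (IsFractionRing.injective T E).comp (FaithfulSMul.algebraMap_injective A T)
  let := FractionRing.liftAlgebra A E
  have := FractionRing.isScalarTower_liftAlgebra A E
  have hsep (t : T) : IsSeparable K (algebraMap T E t) := by
    obtain ⟨F, hF0, hF⟩ := Algebra.IsInvariant.exists_aeval_eq_zero (A := A) (Γ := Γ) (t : S)
    have hev (P : Polynomial A) : Polynomial.aeval (algebraMap T E t)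
        (P.map (algebraMap A K)) = algebraMap T E (Polynomial.aeval t P) := by
      rw [Polynomial.aeval_map_algebraMap, Polynomial.aeval_algebraMap_apply]
    have h0 : Polynomial.aeval (algebraMap T E t) (F.map (algebraMap A K)) = 0 := by
      rw [hev, show Polynomial.aeval t F = 0 from Subtype.ext (by simpa using hF0), map_zero]
    have h1 : Polynomial.aeval (algebraMap T E t) (F.derivative.map (algebraMap A K)) ≠ 0 := by
      rw [hev, Ne, IsFractionRing.to_map_eq_zero_iff]
      intro h
      have : Polynomial.aeval (t : S) F.derivative = 0 := by
        rw [← Polynomial.aeval_subalgebra_coe, h]; rfl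
      rw [hF, Finset.prod_eq_zero_iff] at this
      obtain ⟨s, hs, hs0⟩ := this
      exact (Finset.mem_erase.mp hs).1 (sub_eq_zero.mp hs0).symm
    have hint : IsIntegral K (algebraMap T E t) := by
      refine isAlgebraic_iff_isIntegral.mp ⟨F.map (algebraMap A K), fun h => h1 ?_, h0⟩
      rw [← Polynomial.derivative_map, h, Polynomial.derivative_zero, map_zero]
    rw [IsSeparable, Polynomial.separable_iff_derivative_ne_zero (minpoly.irreducible hint)]
    intro hd
    obtain ⟨Q, hQ⟩ := minpoly.dvd K _ h0
    apply h1
    rw [← Polynomial.derivative_map, hQ, Polynomial.derivative_mul, hd]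
    simp
  have : Algebra.IsSeparable K E := ⟨fun x => by
    obtain ⟨a, b, -, rfl⟩ := IsFractionRing.div_surjective (A := T) x
    exact mem_separableClosure_iff.mp
      (div_mem (mem_separableClosure_iff.mpr (hsep a)) (mem_separableClosure_iff.mpr (hsep b)))⟩
  have : Algebra.FormallyEtale K E := Algebra.FormallyEtale.of_isSeparable K E
  have : Algebra.FormallyEtale A K := Algebra.FormallyEtale.of_isLocalization (nonZeroDivisors A)
  exact Algebra.FormallySmooth.comp A K E

/-- Two points in the same fibre of the quotient by `H`: if `g` acts trivially modulo `q` on the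
`H`-invariants, then some `g * h` acts trivially modulo `q` on a given finite family. -/
theorem exists_mem_forall_map_smul_eq {S B Γ ι : Type*} [CommRing S] [CommRing B] [IsDomain B]
    [Finite ι] [Group Γ] [Finite Γ] [MulSemiringAction Γ S] (H : Subgroup Γ) (q : S →+* B) (g : Γ)
    (hg : ∀ c : S, (∀ h ∈ H, h • c = c) → q (g • c) = q c) (x : ι → S) :
    ∃ h ∈ H, ∀ i, q ((g * h) • x i) = q (x i) := by
  classical
  cases nonempty_fintype Γ
  cases nonempty_fintype ι
  let e := Fintype.equivFin ι
  let P : Polynomial S := ∑ i, Polynomial.C (x i) * Polynomial.X ^ (e i : ℕ)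
  have hP (i : ι) : P.coeff (e i) = x i := by
    simp only [P]
    rw [Polynomial.finsetSum_coeff, Finset.sum_eq_single i]
    · simp
    · intro j _ hne
      rw [Polynomial.coeff_C_mul_X_pow, if_neg]
      exact fun heq => hne (e.injective (Fin.ext heq.symm))
    · simp
  let χ := MulSemiringAction.charpoly H P
  have hχ (n m : ℕ) : q (g • (χ.coeff n).coeff m) = q ((χ.coeff n).coeff m) := by
    refine hg _ fun h hh => ?_
    have : (⟨h, hh⟩ : H) • χ.coeff n = χ.coeff n := MulSemiringAction.smul_coeff_charpoly _ _ _
    conv_rhs => rw [← this]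
    rfl
  have h1 : χ.map (Polynomial.mapRingHom (q.comp (MulSemiringAction.toRingHom Γ S g))) =
      χ.map (Polynomial.mapRingHom q) := by
    ext n m
    simpa using hχ n m
  have h2 : (χ.map (Polynomial.mapRingHom q)).eval (P.map q) = 0 := by
    have : χ.eval P = 0 := MulSemiringAction.eval_charpoly _ _
    rw [← Polynomial.coe_mapRingHom, Polynomial.eval_map, Polynomial.eval₂_hom, this, map_zero]
  rw [← h1] at h2
  simp only [χ, MulSemiringAction.charpoly, Polynomial.map_prod, Polynomial.eval_prod,
    Finset.prod_eq_zero_iff] at h2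
  obtain ⟨h, -, hh⟩ := h2
  simp only [Polynomial.map_sub, Polynomial.map_X, Polynomial.map_C, Polynomial.eval_sub,
    Polynomial.eval_X, Polynomial.eval_C, sub_eq_zero] at hh
  refine ⟨h, h.2, fun i => ?_⟩
  have := congrArg (fun Q => Polynomial.coeff Q (e i)) hh
  simp only [Polynomial.coe_mapRingHom, Polynomial.coeff_map, hP, Polynomial.coeff_smul] at this
  rw [this, mul_smul]
  rfl

section Augmentation

theorem mem_pow_idealOfVars_of_pow_mem {σ k : Type*} [CommRing k] [IsDomain k] {d M : ℕ}
    (hd : d ≠ 0) {y : MvPolynomial σ k} (h : y ^ d ∈ idealOfVars σ k ^ (d * M)) :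
    y ∈ idealOfVars σ k ^ M := by
  have horder (z : MvPolynomial σ k) (r : ℕ) :
      z ∈ idealOfVars σ k ^ r ↔ (r : ℕ∞) ≤ MvPowerSeries.order (z : MvPowerSeries σ k) := by
    rw [mem_pow_idealOfVars_iff']
    constructor
    · exact fun hz => MvPowerSeries.nat_le_order fun α hα => by
        rw [coeff_coe]; exact hz α hα
    · intro hz α hα
      rw [← coeff_coe]
      exact MvPowerSeries.coeff_of_lt_order (lt_of_lt_of_le (by exact_mod_cast hα) hz)
  have hpow (r : ℕ) : MvPowerSeries.order ((y : MvPowerSeries σ k) ^ r) =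
      r * MvPowerSeries.order (y : MvPowerSeries σ k) := by
    induction r with
    | zero =>
      rw [pow_zero, Nat.cast_zero, zero_mul]
      exact not_ne_iff.mp (mt MvPowerSeries.order_ne_zero_iff_constCoeff_eq_zero.mp (by simp))
    | succ r ih => rw [pow_succ, MvPowerSeries.order_mul, ih]; push_cast; ring
  rw [horder, coe_pow, hpow] at h
  rw [horder]
  push_cast at h
  exact (ENat.mul_le_mul_left_iff (by exact_mod_cast hd) (ENat.natCast_ne_top d)).mp h

theorem map_pow_eq_zero_of_aeval_eq_zero {A k R B : Type*} [CommRing A] [CommRing k] [CommRing R]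
    [CommRing B] [Algebra A R] {ε : A →+* k} {φ : R →+* B} {φ' : k →+* B}
    (h : ∀ a, φ (algebraMap A R a) = φ' (ε a)) {F : Polynomial A} {d : ℕ}
    (hF : F.map ε = Polynomial.X ^ d) {t : R} (ht : Polynomial.aeval t F = 0) :
    φ t ^ d = 0 := by
  have h1 : φ.comp (algebraMap A R) = φ'.comp ε := RingHom.ext h
  rw [← map_zero φ, ← ht, Polynomial.aeval_def, Polynomial.hom_eval₂, h1, ← Polynomial.eval₂_map,
    hF, Polynomial.eval₂_X_pow]

theorem Algebra.IsInvariant.exists_aeval_eq_zero_and_map_eq_X_pow {A S Γ k : Type*} [CommRing A]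
    [CommRing S] [CommRing k] [Algebra A S] [Group Γ] [Finite Γ] [MulSemiringAction Γ S]
    [Algebra.IsInvariant A S Γ] {ε : A →+* k} {η : S →+* k}
    (hη : ∀ a, η (algebraMap A S a) = ε a) (hΓ : ∀ (g : Γ) s, η (g • s) = η s) {x : S}
    (hx : η x = 0) :
    ∃ F : Polynomial A, Polynomial.aeval x F = 0 ∧ F.map ε = Polynomial.X ^ Nat.card Γ := by
  cases nonempty_fintype Γ
  obtain ⟨F, hF⟩ := (Polynomial.mem_lifts _).mp (Algebra.IsInvariant.charpoly_mem_lifts A S Γ x)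
  refine ⟨F, ?_, ?_⟩
  · rw [Polynomial.aeval_def, ← Polynomial.eval_map, hF, MulSemiringAction.eval_charpoly]
  · have : ε = η.comp (algebraMap A S) := (RingHom.ext hη).symm
    rw [this, ← Polynomial.map_map, hF, MulSemiringAction.charpoly, Polynomial.map_prod]
    simp [hΓ, hx]

theorem exists_pow_idealOfVars_le_map {σ τ k Γ : Type*} [Field k] [Finite σ]
    [Algebra (MvPolynomial τ k) (MvPolynomial σ k)] [Group Γ] [Finite Γ]
    [MulSemiringAction Γ (MvPolynomial σ k)]
    [Algebra.IsInvariant (MvPolynomial τ k) (MvPolynomial σ k) Γ]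
    (hη : ∀ a : MvPolynomial τ k,
      constantCoeff (algebraMap (MvPolynomial τ k) (MvPolynomial σ k) a) = constantCoeff a)
    (hΓ : ∀ (g : Γ) (s : MvPolynomial σ k), constantCoeff (g • s) = constantCoeff s) :
    ∃ M, idealOfVars σ k ^ M ≤
      (idealOfVars τ k).map (algebraMap (MvPolynomial τ k) (MvPolynomial σ k)) := by
  set J := (idealOfVars τ k).map (algebraMap (MvPolynomial τ k) (MvPolynomial σ k))
  refine Ideal.exists_pow_le_of_le_radical_of_fg ?_ (Submodule.fg_span (Set.finite_range _))
  rw [idealOfVars, Ideal.span_le]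
  rintro _ ⟨i, rfl⟩
  obtain ⟨F, hF0, hF⟩ := Algebra.IsInvariant.exists_aeval_eq_zero_and_map_eq_X_pow hη hΓ
    (constantCoeff_X (R := k) i)
  refine ⟨Nat.card Γ, ?_⟩
  rw [← Ideal.Quotient.eq_zero_iff_mem, map_pow]
  refine map_pow_eq_zero_of_aeval_eq_zero (φ := Ideal.Quotient.mk J)
    (φ' := (Ideal.Quotient.mk J).comp ((algebraMap _ _).comp (C : k →+* MvPolynomial τ k)))
    (fun a => ?_) hF hF0
  rw [RingHom.comp_apply, RingHom.comp_apply, Ideal.Quotient.eq, ← map_sub]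
  refine Ideal.mem_map_of_mem _ ?_
  rw [← pow_one (idealOfVars τ k), mem_pow_idealOfVars_iff']
  intro α hα
  rw [Nat.lt_one_iff, Finsupp.degree_eq_zero_iff] at hα
  rw [hα, coeff_sub, coeff_zero_C, constantCoeff_eq, sub_self]

/-- The Artin–Rees lemma for a subalgebra. -/
theorem Subalgebra.exists_mem_map_of_mem_map_pow {A S : Type*} [CommRing A] [IsNoetherianRing A]
    [CommRing S] [Algebra A S] [Module.Finite A S] (T : Subalgebra A S) (I : Ideal A) :
    ∃ r, ∀ y : T, (y : S) ∈ (I ^ r).map (algebraMap A S) → y ∈ I.map (algebraMap A T) := by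
  obtain ⟨r, hr⟩ := Ideal.exists_pow_inf_eq_pow_smul I (Subalgebra.toSubmodule T)
  refine ⟨r + 1, fun y hy => ?_⟩
  have h1 : (y : S) ∈ I ^ (r + 1) • (⊤ : Submodule A S) ⊓ Subalgebra.toSubmodule T :=
    ⟨by rw [Ideal.smul_top_eq_map]; exact hy, y.2⟩
  rw [hr _ (Nat.le_add_right r 1), Nat.add_sub_cancel_left, pow_one] at h1
  have h2 : (y : S) ∈ (I • (⊤ : Submodule A T)).map T.val.toLinearMap := by
    rw [Submodule.map_smul'']
    refine Submodule.smul_mono le_rfl ?_ h1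
    rintro z ⟨-, hz⟩
    exact ⟨⟨z, hz⟩, trivial, rfl⟩
  obtain ⟨z, hz, hzy⟩ := h2
  rw [show y = z from Subtype.ext hzy.symm]
  rwa [Ideal.smul_top_eq_map] at hz

theorem DerivationsModIntegral.smul_eq {σ τ k Γ : Type*} [Field k] [Finite σ] [Finite τ]
    [Algebra (MvPolynomial τ k) (MvPolynomial σ k)]
    [IsScalarTower k (MvPolynomial τ k) (MvPolynomial σ k)]
    [FaithfulSMul (MvPolynomial τ k) (MvPolynomial σ k)] [Group Γ] [Finite Γ]
    [MulSemiringAction Γ (MvPolynomial σ k)]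
    [SMulCommClass Γ (MvPolynomial τ k) (MvPolynomial σ k)]
    [Algebra.IsInvariant (MvPolynomial τ k) (MvPolynomial σ k) Γ]
    (hη : ∀ a : MvPolynomial τ k,
      constantCoeff (algebraMap (MvPolynomial τ k) (MvPolynomial σ k) a) = constantCoeff a)
    (hΓ : ∀ (g : Γ) (s : MvPolynomial σ k), constantCoeff (g • s) = constantCoeff s)
    (T : Subalgebra (MvPolynomial τ k) (MvPolynomial σ k))
    (hder : DerivationsModIntegral (MvPolynomial τ k) T (FractionRing T))
    (g : Γ) : ∀ t ∈ T, g • t = t := by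
  set A := MvPolynomial τ k
  set S := MvPolynomial σ k
  have : Algebra.IsIntegral A S := Algebra.IsInvariant.isIntegral A S Γ
  have : Algebra.FiniteType A S := Algebra.FiniteType.of_restrictScalars_finiteType k A S
  have : Module.Finite A S := Algebra.IsIntegral.finite
  have : Module.Finite A T := inferInstanceAs (Module.Finite A (Subalgebra.toSubmodule T))
  have := Algebra.IsInvariant.formallySmooth_fractionRing Γ T
  set I := idealOfVars τ k
  set d := Nat.card Γ
  have hd : d ≠ 0 := Nat.card_pos.ne'
  obtain ⟨r, hr⟩ := T.exists_mem_map_of_mem_map_pow I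
  obtain ⟨M, hM⟩ := exists_pow_idealOfVars_le_map hη hΓ
  have hIS : (I.map (algebraMap A T)).map T.val.toRingHom ≤ idealOfVars σ k := by
    rw [Ideal.map_map, Ideal.map_le_iff_le_comap, idealOfVars, Ideal.span_le]
    rintro _ ⟨i, rfl⟩
    change algebraMap A S (X i) ∈ idealOfVars σ k
    rw [← pow_one (idealOfVars σ k), mem_pow_idealOfVars_iff']
    intro α hα
    rw [Nat.lt_one_iff, Finsupp.degree_eq_zero_iff] at hα
    rw [hα, ← constantCoeff_eq, hη, constantCoeff_X]
  obtain ⟨φ, hφA, hφ⟩ := hder.exists_ringHom_quotient (IsFractionRing.injective T (FractionRing T))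
    (Nat.mul_ne_zero hd (Nat.succ_ne_zero (M * r)))
  have hmem (t : T) (ht : constantCoeff (t : S) = 0) : t ∈ I.map (algebraMap A T) := by
    obtain ⟨y, hy, hyt⟩ := hφ t
    obtain ⟨F, hF0, hF⟩ :=
      Algebra.IsInvariant.exists_aeval_eq_zero_and_map_eq_X_pow hη hΓ ht
    have h1 : φ t ^ d = 0 := map_pow_eq_zero_of_aeval_eq_zero
      (φ' := (Ideal.Quotient.mk _).comp ((algebraMap A T).comp (C : k →+* A))) hφA hF
      (Subtype.ext (by rw [Polynomial.aeval_subalgebra_coe, hF0]; rfl))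
    rw [hy, ← map_pow, Ideal.Quotient.eq_zero_iff_mem] at h1
    have h2 : (y : S) ^ d ∈ idealOfVars σ k ^ (d * (M * r + 1)) := by
      refine Ideal.pow_right_mono hIS _ ?_
      rw [← Ideal.map_pow]
      exact Ideal.mem_map_of_mem T.val.toRingHom h1
    have h3 := Ideal.pow_le_pow_right (Nat.le_succ _) (mem_pow_idealOfVars_of_pow_mem hd h2)
    rw [pow_mul] at h3
    have h4 : y ∈ I.map (algebraMap A T) :=
      hr y (by rw [Ideal.map_pow]; exact Ideal.pow_right_mono hM r h3)
    simpa using sub_mem h4 hyt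
  let R := LinearMap.range (Algebra.linearMap A T)
  obtain ⟨a, ha1, ha⟩ := Submodule.exists_sub_one_mem_and_smul_eq_zero_of_fg_of_le_smul I
    (⊤ : Submodule A (T ⧸ R)) Module.Finite.fg_top (by
      rintro x -
      obtain ⟨t, rfl⟩ := Submodule.Quotient.mk_surjective _ x
      have h1 : t - algebraMap A T (C (constantCoeff (t : S))) ∈ I • (⊤ : Submodule A T) := by
        rw [Ideal.smul_top_eq_map]
        refine hmem _ ?_
        rw [Subalgebra.coe_sub, map_sub, Subalgebra.coe_algebraMap, hη, constantCoeff_C, sub_self]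
      have h2 := Submodule.mem_map_of_mem (f := R.mkQ) h1
      rw [Submodule.map_smul'', Submodule.map_top, Submodule.range_mkQ, map_sub,
        show R.mkQ (algebraMap A T _) = 0 from (Submodule.Quotient.mk_eq_zero R).mpr ⟨_, rfl⟩,
        sub_zero] at h2
      exact h2)
  have ha0 : algebraMap A S a ≠ 0 := by
    intro h
    have h1 := hη a
    have h2 : constantCoeff (a - 1) = 0 := by
      rw [← pow_one I, mem_pow_idealOfVars_iff'] at ha1
      exact ha1 0 (by simp)
    rw [h, map_zero] at h1
    rw [map_sub, ← h1] at h2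
    simp at h2
  intro t ht
  have h1 := ha (Submodule.Quotient.mk ⟨t, ht⟩) trivial
  rw [← Submodule.Quotient.mk_smul, Submodule.Quotient.mk_eq_zero] at h1
  obtain ⟨b, hb⟩ := h1
  have hb' : algebraMap A S b = algebraMap A S a * t := by
    have := congrArg Subtype.val hb
    rwa [Algebra.smul_def] at this
  have h2 : g • (algebraMap A S a * t) = algebraMap A S a * t := by
    rw [← hb', smul_algebraMap]
  rw [smul_mul', smul_algebraMap] at h2
  exact mul_left_cancel₀ ha0 h2

end Augmentation

section Linear

/-- Modulo a prime of a polynomial ring in at least two variables, a ring over which the polynomial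
ring is integral has infinite image. -/
theorem MvPolynomial.infinite_range_mk_algebraMap {A σ k : Type*} [CommRing A] [Field k]
    [Nontrivial σ] [Algebra A (MvPolynomial σ k)] [Algebra.IsIntegral A (MvPolynomial σ k)]
    {π : MvPolynomial σ k} (hπ : Prime π) :
    (Set.range fun a : A =>
      Ideal.Quotient.mk (Ideal.span {π}) (algebraMap A (MvPolynomial σ k) a)).Infinite := by
  classical
  set B := MvPolynomial σ k ⧸ Ideal.span {π}
  intro hfin
  have hbot : Finite (⊥ : Subalgebra A B) := by
    refine Set.Finite.to_subtype ?_
    rw [Algebra.coe_bot]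
    exact hfin
  have hpow (j : σ) : ∃ a b : ℕ, a ≠ b ∧ π ∣ X j ^ a - X j ^ b := by
    set x : B := Ideal.Quotient.mk _ (X j)
    have hx : IsIntegral A x :=
      (Algebra.IsIntegral.isIntegral (R := A) (X j : MvPolynomial σ k)).map
        (Ideal.Quotient.mkₐ A (Ideal.span {π}))
    have hx' : IsIntegral (⊥ : Subalgebra A B) x := hx.tower_top
    have : Module.Finite (⊥ : Subalgebra A B) (Algebra.adjoin (⊥ : Subalgebra A B) {x}) :=
      Module.Finite.iff_fg.mpr hx'.fg_adjoin_singleton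
    have : Finite (Algebra.adjoin (⊥ : Subalgebra A B) {x}) :=
      Module.finite_of_finite (⊥ : Subalgebra A B)
    obtain ⟨a, b, hab, hne⟩ := Function.not_injective_iff.mp (not_injective_infinite_finite
      fun r : ℕ => (⟨x, Algebra.self_mem_adjoin_singleton _ x⟩ :
        Algebra.adjoin (⊥ : Subalgebra A B) {x}) ^ r)
    refine ⟨a, b, hne, ?_⟩
    rw [← Ideal.mem_span_singleton, ← Ideal.Quotient.eq, map_pow, map_pow]
    exact congrArg Subtype.val hab
  have hdeg (i : σ) : degreeOf i π = 0 := by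
    obtain ⟨j, hj⟩ := exists_ne i
    obtain ⟨a, b, hne, c, hc⟩ := hpow j
    have h0 : (X j ^ a - X j ^ b : MvPolynomial σ k) ≠ 0 := by
      rw [sub_ne_zero, X_pow_eq_monomial, X_pow_eq_monomial]
      intro h
      rw [monomial_left_inj one_ne_zero] at h
      exact hne (Finsupp.single_injective j h)
    have hc0 : c ≠ 0 := by rintro rfl; exact h0 (by rw [hc, mul_zero])
    have h1 : degreeOf i (X j ^ a - X j ^ b : MvPolynomial σ k) = 0 := by
      refine Nat.le_zero.mp ((degreeOf_sub_le _ _ _).trans ?_)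
      simp [degreeOf_X_pow_of_ne _ hj.symm]
    rw [hc, degreeOf_mul_eq hπ.ne_zero hc0] at h1
    omega
  have hC : π = C (coeff 0 π) := by
    rw [← totalDegree_eq_zero_iff_eq_C, totalDegree_eq_zero_iff]
    intro m hm x
    exact Nat.le_zero.mp ((monomial_le_degreeOf x hm).trans (hdeg x).le)
  refine hπ.not_isUnit ?_
  rw [hC]
  refine (IsUnit.mk0 _ fun h => hπ.ne_zero ?_).map C
  rw [hC, h, C_0]

/-- A nonzero matrix whose columns, as linear forms, have a common prime divisor has rank one. -/
theorem Matrix.finrank_ker_mulVecLin_add_one_of_dvd {k : Type*} [Field k] {n : ℕ}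
    {N : Matrix (Fin n) (Fin n) k} (hN : N ≠ 0) {π : MvPolynomial (Fin n) k} (hπ : Prime π)
    (h : ∀ j, π ∣ ∑ i, C (N i j) * X i) :
    Module.finrank k (LinearMap.ker N.mulVecLin) + 1 = n := by
  choose c hc using h
  have hdeg (j) : totalDegree (∑ i, C (N i j) * X i : MvPolynomial (Fin n) k) ≤ 1 := by
    refine (totalDegree_finsetSum _ _).trans (Finset.sup_le fun i _ => ?_)
    refine (totalDegree_mul _ _).trans ?_
    simp
  have hπ1 : totalDegree π ≠ 0 := by
    intro h0
    rw [totalDegree_eq_zero_iff_eq_C] at h0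
    refine hπ.not_isUnit ?_
    rw [h0]
    refine (IsUnit.mk0 _ fun h => hπ.ne_zero ?_).map C
    rw [h0, h, C_0]
  have hcC (j) : c j = C (coeff 0 (c j)) := by
    rcases eq_or_ne (c j) 0 with h0 | h0
    · simp [h0]
    · have := hdeg j
      rw [hc, totalDegree_mul_of_isDomain hπ.ne_zero h0] at this
      rw [← totalDegree_eq_zero_iff_eq_C]
      omega
  have hvec : N = vecMulVec (fun i => coeff (Finsupp.single i 1) π) fun j => coeff 0 (c j) := by
    ext i j
    have := congrArg (coeff (Finsupp.single i 1)) (hc j)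
    rw [hcC j, mul_comm π, coeff_C_mul, coeff_sum] at this
    simp only [coeff_C_mul, coeff_X, Finsupp.single_left_inj one_ne_zero] at this
    rw [vecMulVec_apply, mul_comm]
    simpa using this
  have hle : N.rank ≤ 1 := by rw [hvec]; exact rank_vecMulVec_le _ _
  have hne : N.rank ≠ 0 := fun h => by
    rw [Matrix.rank, Submodule.finrank_eq_zero, LinearMap.range_eq_bot] at h
    exact hN (Matrix.toLin'.map_eq_zero_iff.mp h)
  have := LinearMap.finrank_range_add_finrank_ker N.mulVecLin
  rw [Module.finrank_fin_fun] at this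
  rw [Matrix.rank] at hle hne
  omega

end Linear

/-- An isomorphism onto a polynomial ring can be translated so that the coordinate functions
correspond to elements killed by a given augmentation. -/
theorem exists_algEquiv_comp_symm_eq_constantCoeff {k R τ : Type*} [CommRing k] [CommRing R]
    [Algebra k R] (e : R ≃ₐ[k] MvPolynomial τ k) (η : R →ₐ[k] k) :
    ∃ e' : R ≃ₐ[k] MvPolynomial τ k, ∀ a, η (e'.symm a) = constantCoeff a := by
  let c (i : τ) : k := η (e.symm (X i))
  let tr : MvPolynomial τ k ≃ₐ[k] MvPolynomial τ k :=
    AlgEquiv.ofAlgHom (aeval fun i => X i + C (c i)) (aeval fun i => X i - C (c i))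
      (by ext i : 1; simp [algHom_C]) (by ext i : 1; simp [algHom_C])
  refine ⟨e.trans tr, fun a => ?_⟩
  have : η.comp (e.trans tr).symm.toAlgHom = aeval fun _ : τ => (0 : k) := by
    ext i
    have htr : tr.symm (X i) = X i - C (c i) := by simp [tr]
    simp only [AlgHom.comp_apply, AlgEquiv.coe_toAlgHom, AlgEquiv.symm_trans_apply, aeval_X, htr,
      map_sub]
    rw [← algebraMap_eq, AlgEquiv.commutes, AlgHom.commutes]
    exact sub_self _
  have h := AlgHom.congr_fun this a
  rw [AlgHom.comp_apply] at h
  refine h.trans ?_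
  simp

/-- **Serre's theorem.**
Let `k` be a field of arbitrary characteristic, `V = k^n` a finite-dimensional `k`-vector
space, and `G` a finite subgroup of `GL(V) = GL_n(k)`.  `G` acts by `k`-algebra automorphisms
on the algebra of polynomial functions on `V` (the symmetric algebra `S(V*)`, here the
polynomial ring `k[x_1, …, x_n]`) by linear substitutions `g • x_j = ∑ i, g i j • x_i`, encoded
by the homomorphism `ψ`.  If the invariant ring `S(V*)^G` is isomorphic as a `k`-algebra to a
polynomial ring, then `G` is generated by pseudo-reflections, i.e. by elements `g ≠ 1` whose
fixed subspace `ker (g - 1)` has codimension `1` in `V`. -/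
theorem serre_polynomial_invariants_imp_pseudoReflection
    (k : Type*) [Field k] (n : ℕ)
    (G : Subgroup (GL (Fin n) k)) [Finite G]
    (ψ : ↥G →* (MvPolynomial (Fin n) k ≃ₐ[k] MvPolynomial (Fin n) k))
    (hψ : ∀ (g : ↥G) (j : Fin n),
      ψ g (X j) =
        ∑ i, C (((g : GL (Fin n) k) : Matrix (Fin n) (Fin n) k) i j) * X i)
    (hpoly : ∃ m : ℕ, Nonempty (↥(invariantSubalgebra ψ) ≃ₐ[k] MvPolynomial (Fin m) k)) :
    Subgroup.closure
      {g : GL (Fin n) k | g ∈ G ∧ g ≠ 1 ∧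
        Module.finrank k
          ↥(LinearMap.ker (Matrix.mulVecLin ((g : Matrix (Fin n) (Fin n) k) - 1))) + 1 = n}
      = G := by
  set R := {g : GL (Fin n) k | g ∈ G ∧ g ≠ 1 ∧
    Module.finrank k
      ↥(LinearMap.ker (Matrix.mulVecLin ((g : Matrix (Fin n) (Fin n) k) - 1))) + 1 = n}
  refine le_antisymm ((Subgroup.closure_le _).mpr fun g hg => hg.1) ?_
  have hrefl (g : G) (hg : g ≠ 1) {π : MvPolynomial (Fin n) k} (hπ : Prime π)
      (h : ∀ j, π ∣ ∑ i, C (((g : GL (Fin n) k) : Matrix (Fin n) (Fin n) k) i j -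
        (1 : Matrix (Fin n) (Fin n) k) i j) * X i) : (g : GL (Fin n) k) ∈ R := by
    have hg' : (g : GL (Fin n) k) ≠ 1 := by simpa using hg
    refine ⟨g.2, hg', Matrix.finrank_ker_mulVecLin_add_one_of_dvd ?_ hπ h⟩
    exact sub_ne_zero.mpr fun h => hg' (Units.ext h)
  rcases subsingleton_or_nontrivial (Fin n) with _ | _
  · intro g hg
    rcases eq_or_ne g 1 with rfl | hne
    · exact one_mem _
    have hN : ∃ i : Fin n, True := by
      by_contra! hn
      exact hne (Units.ext (Matrix.ext fun i => (hn i).elim))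
    obtain ⟨i, -⟩ := hN
    refine Subgroup.subset_closure (hrefl ⟨g, hg⟩ (by simpa using hne) (X_prime (i := i))
      fun j => Finset.dvd_sum fun l _ => ?_)
    rw [Subsingleton.elim l i]
    exact dvd_mul_left _ _
  obtain ⟨m, ⟨e⟩⟩ := hpoly
  obtain ⟨e, he⟩ := exists_algEquiv_comp_symm_eq_constantCoeff e
    ((aeval fun _ : Fin n => (0 : k)).comp (invariantSubalgebra ψ).val)
  set A := MvPolynomial (Fin m) k
  set S := MvPolynomial (Fin n) k
  let ρ : A →ₐ[k] S := (invariantSubalgebra ψ).val.comp e.symm.toAlgHom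
  let : MulSemiringAction G S := MulSemiringAction.compHom S ψ
  let : Algebra A S := ρ.toAlgebra
  have hsmul (g : G) (s : S) : g • s = ψ g s := rfl
  have hρ (a : A) : algebraMap A S a = e.symm a := rfl
  have : IsScalarTower k A S := IsScalarTower.of_algHom ρ
  have : FaithfulSMul A S := (faithfulSMul_iff_algebraMap_injective A S).mpr
    (Subtype.val_injective.comp e.symm.injective)
  have : SMulCommClass G A S := ⟨fun g a s => by
    rw [Algebra.smul_def, Algebra.smul_def, smul_mul', hρ, hsmul g (e.symm a : S),
      (e.symm a).2 g]⟩
  have : Algebra.IsInvariant A S G := ⟨fun s hs =>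
    ⟨e ⟨s, hs⟩, by rw [hρ, AlgEquiv.symm_apply_apply]⟩⟩
  have : Algebra.IsIntegral A S := Algebra.IsInvariant.isIntegral A S G
  have hη (a : A) : constantCoeff (algebraMap A S a) = constantCoeff a := by
    rw [← he, hρ]
    simp
  have hΓ (g : G) (s : S) : constantCoeff (g • s) = constantCoeff s := by
    have : (aeval fun _ : Fin n => (0 : k)).comp (ψ g).toAlgHom =
        aeval fun _ : Fin n => (0 : k) := by
      ext j
      simp [hψ]
    rw [hsmul]
    simpa using AlgHom.congr_fun this s
  have hlin (g : G) (j : Fin n) : g • (X j : S) - X j =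
      ∑ i, C (((g : GL (Fin n) k) : Matrix (Fin n) (Fin n) k) i j -
        (1 : Matrix (Fin n) (Fin n) k) i j) * X i := by
    simp [hsmul, hψ, sub_mul, Matrix.one_apply]
  let H : Subgroup G := (Subgroup.closure R).subgroupOf G
  let T : Subalgebra A S := FixedPoints.subalgebra A S H
  have hT (t : S) : t ∈ T ↔ ∀ h ∈ H, h • t = t :=
    ⟨fun ht h hh => ht ⟨h, hh⟩, fun ht h => ht h h.2⟩
  have hsep (π : S) (hπ : Prime π) (g : G) (hg : g ∉ H) : ∃ c ∈ T, ¬ π ∣ g • c - c := by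
    by_contra! hcon
    have : (Ideal.span {π}).IsPrime := (Ideal.span_singleton_prime hπ.ne_zero).mpr hπ
    obtain ⟨h, hh, hgh⟩ := exists_mem_forall_map_smul_eq H (Ideal.Quotient.mk (Ideal.span {π})) g
      (fun c hc => Ideal.Quotient.eq.mpr (Ideal.mem_span_singleton.mpr (hcon c ((hT c).mpr hc))))
      (X : Fin n → S)
    refine hg ((Subgroup.mul_mem_cancel_right H hh).mp ?_)
    rcases eq_or_ne (g * h) 1 with h1 | h1
    · rw [h1]; exact one_mem _
    refine Subgroup.mem_subgroupOf.mpr (Subgroup.subset_closure (hrefl _ h1 hπ fun j => ?_))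
    rw [← hlin, ← Ideal.mem_span_singleton, ← Ideal.Quotient.eq]
    exact hgh j
  have hder : DerivationsModIntegral A T (FractionRing T) :=
    derivation_mem_range T hT (fun π hπ => infinite_range_mk_algebraMap hπ) hsep
  intro g hg
  obtain ⟨h, hh, hgh⟩ := exists_mem_forall_map_smul_eq H (RingHom.id S) ⟨g, hg⟩
    (fun c hc => hder.smul_eq hη hΓ T _ c ((hT c).mpr hc)) (X : Fin n → S)
  have h1 : (⟨g, hg⟩ : G) * h = 1 := by
    refine Subtype.ext (Units.ext (Matrix.ext fun i j => ?_))
    have := hlin (⟨g, hg⟩ * h) j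
    rw [show _ • (X j : S) = X j from hgh j, sub_self] at this
    replace this := congrArg (coeff (Finsupp.single i 1)) this
    simp only [coeff_zero, coeff_sum, coeff_C_mul, coeff_X, Finsupp.single_left_inj one_ne_zero]
      at this
    exact sub_eq_zero.mp (by simpa using this.symm)
  exact Subgroup.mem_subgroupOf.mp
    ((Subgroup.mul_mem_cancel_right H hh).mp (by rw [h1]; exact one_mem H))
end

section
/- Let k be a field, K a finitely generated field extension of k, and G a finite group of k-algebra automorphisms of K. Then there exists a finitely generated k-subalgebra A of K such that K is the fraction field of A (every element of K is a quotient of elements of A) and A is stable under G, i.e., g(A) = A for every g ∈ G. (This is the algebraic form of: a finite group of birational automorphisms of an affine variety acts by biregular automorphisms on some G-invariant affine open subset.) -/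
/-- **Equivariant choice of an affine model (algebraic form of Lemma on invariant open
subsets).**
Let `k` be a field, `K` a finitely generated field extension of `k`, and `G` a finite group of
`k`-algebra automorphisms of `K`.  Then there exists a finitely generated `k`-subalgebra
`A ⊆ K` such that `K` is the fraction field of `A` (every element of `K` is a quotient
`a * b⁻¹` with `a, b ∈ A`, `b ≠ 0`) and `A` is stable under `G`: `g(A) = A` for every `g ∈ G`.
Geometrically: a finite group of birational automorphisms of an affine variety acts by
biregular automorphisms on some `G`-invariant affine open subset. -/
theorem exists_invariant_finitelyGenerated_model
    (k K : Type*) [Field k] [Field K] [Algebra k K]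
    (hfg : (⊤ : IntermediateField k K).FG)
    (G : Subgroup (K ≃ₐ[k] K)) [Finite G] :
    ∃ A : Subalgebra k K, A.FG ∧
      (∀ x : K, ∃ a b : K, a ∈ A ∧ b ∈ A ∧ b ≠ 0 ∧ x = a * b⁻¹) ∧
      (∀ g ∈ G, A.map (g : K ≃ₐ[k] K).toAlgHom = A) := by
  obtain ⟨S, hS⟩ := hfg
  let T : Set K := ⋃ g : G, (g : K ≃ₐ[k] K) '' (S : Set K)
  have hT : T.Finite := Set.finite_iUnion fun g => S.finite_toSet.image _
  have hST : (S : Set K) ⊆ T := fun x hx => Set.mem_iUnion.2 ⟨1, x, hx, rfl⟩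
  have map_le : ∀ g ∈ G, (Algebra.adjoin k T).map (g : K ≃ₐ[k] K).toAlgHom ≤
      Algebra.adjoin k T := by
    intro g hg
    rw [AlgHom.map_adjoin]
    refine Algebra.adjoin_mono ?_
    rintro _ ⟨y, hy, rfl⟩
    obtain ⟨h, x, hx, rfl⟩ := Set.mem_iUnion.1 hy
    exact Set.mem_iUnion.2 ⟨⟨g, hg⟩ * h, x, hx, rfl⟩
  refine ⟨Algebra.adjoin k T, Subalgebra.fg_def.2 ⟨T, hT, rfl⟩, fun x => ?_,
    fun g hg => le_antisymm (map_le g hg) fun y hy => ?_⟩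
  · have hx : x ∈ IntermediateField.adjoin k T :=
      IntermediateField.adjoin.mono k _ _ hST (hS ▸ IntermediateField.mem_top)
    obtain ⟨a, ha, b, hb, rfl⟩ := IntermediateField.mem_adjoin_iff_div.1 hx
    by_cases hb0 : b = 0
    · exact ⟨0, 1, zero_mem _, one_mem _, one_ne_zero, by simp [hb0]⟩
    · exact ⟨a, b, ha, hb, hb0, div_eq_mul_inv a b⟩
  · exact ⟨g⁻¹ y, map_le g⁻¹ (inv_mem hg) ⟨y, hy, rfl⟩, g.apply_symm_apply y⟩
end

section
/- Let R be a domain (not necessarily commutative) such that the set R∖{0} of nonzero elements satisfies the right Ore condition, so that the skew field of fractions Frac R = R_{R∖{0}} exists. Let S be a submonoid of R∖{0} satisfying the right Ore condition, so the Ore localization R_S exists. Then R_S is again a domain whose nonzero elements satisfy the right Ore condition, and there is a ring isomorphism Frac(R_S) ≅ Frac R. -/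
/-- A submonoid `S` of a ring `R` satisfies the right Ore condition if for every `r ∈ R` and
`s ∈ S` there exist `r' ∈ R` and `s' ∈ S` with `r * s' = s * r'`. -/
def RightOre (R : Type*) [Ring R] (S : Submonoid R) : Prop :=
  ∀ (r : R) (s : S), ∃ (r' : R) (s' : S), r * (s' : R) = (s : R) * r'

/-- `L`, together with the ring embedding `ι : R →+* L`, is a right Ore localization of `R` at
the submonoid `S`: `ι` is injective, every element of `S` becomes a unit in `L`, and every
element of `L` is a right fraction `ι a * (ι s)⁻¹` with `a ∈ R`, `s ∈ S`.  When `S` consists of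
all nonzero elements of a domain and `L` is a division ring, this says that `L` is the skew
field of fractions `Frac R`. -/
def IsRightOreLocalization {R L : Type*} [Ring R] [Ring L] (S : Submonoid R)
    (ι : R →+* L) : Prop :=
  Function.Injective ι ∧
    (∀ s : S, IsUnit (ι s)) ∧
    (∀ x : L, ∃ (a : R) (s : S) (u : Lˣ), (u : L) = ι s ∧ x = ι a * ((u⁻¹ : Lˣ) : L))

/-- In a right Ore localization, every element becomes the image of an
element of `R` after right multiplication by an element of `S`. -/
theorem IsRightOreLocalization.exists_mul_eq {R L : Type*} [Ring R] [Ring L] {S : Submonoid R}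
    {ι : R →+* L} (h : IsRightOreLocalization S ι) (x : L) :
    ∃ (a : R) (s : S), x * ι s = ι a := by
  obtain ⟨a, s, u, hu, rfl⟩ := h.2.2 x
  exact ⟨a, s, by rw [← hu, mul_assoc, Units.inv_mul, mul_one]⟩

/-- A division ring in which every element is a right fraction of images of an embedded domain
`R` is a right Ore localization of `R` at its nonzero elements. -/
theorem IsRightOreLocalization.of_exists_mul_eq {R K : Type*} [Ring R] [IsDomain R]
    [DivisionRing K] {ι : R →+* K} (hι : Function.Injective ι)
    (h : ∀ x : K, ∃ a s : R, s ≠ 0 ∧ x * ι s = ι a) :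
    IsRightOreLocalization (nonZeroDivisors R) ι := by
  have hne {s : R} (hs : s ≠ 0) : ι s ≠ 0 := (map_ne_zero_iff ι hι).2 hs
  refine ⟨hι, fun s => (hne (nonZeroDivisors.ne_zero s.2)).isUnit, fun x => ?_⟩
  obtain ⟨a, s, hs, hx⟩ := h x
  exact ⟨a, ⟨s, mem_nonZeroDivisors_of_ne_zero hs⟩, Units.mk0 _ (hne hs), rfl, by
    rw [← hx, mul_assoc, Units.val_inv_eq_inv_val, Units.val_mk0, mul_inv_cancel₀ (hne hs),
      mul_one]⟩

theorem RightOre.exists_mul_eq_mul {R : Type*} [Ring R] [IsDomain R]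
    (hR : RightOre R (nonZeroDivisors R)) (a : R) {b : R} (hb : b ≠ 0) :
    ∃ a' b' : R, b' ≠ 0 ∧ a * b' = b * a' := by
  obtain ⟨a', b', h⟩ := hR a ⟨b, mem_nonZeroDivisors_of_ne_zero hb⟩
  exact ⟨a', b', nonZeroDivisors.ne_zero b'.2, h⟩

/-- A right Ore localization of a domain is a domain. -/
theorem IsRightOreLocalization.isDomain {R L : Type*} [Ring R] [IsDomain R] [Ring L]
    {S : Submonoid R} (hS : S ≤ nonZeroDivisors R) (hSOre : RightOre R S) {ι : R →+* L}
    (h : IsRightOreLocalization S ι) : IsDomain L := by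
  have : Nontrivial L := h.1.nontrivial
  have : NoZeroDivisors L := by
    refine ⟨fun {x y} hxy => ?_⟩
    obtain ⟨a, s, hx⟩ := h.exists_mul_eq x
    obtain ⟨b, t, hy⟩ := h.exists_mul_eq y
    obtain ⟨b', s', hb⟩ := hSOre b s
    have hab : a * b' = 0 := by
      apply h.1
      rw [map_mul, ← hx, mul_assoc, ← map_mul, ← hb, map_mul, ← hy, ← mul_assoc, ← mul_assoc,
        hxy, zero_mul, zero_mul, map_zero]
    rcases mul_eq_zero.1 hab with rfl | rfl
    · left
      rwa [map_zero, (h.2.1 s).mul_left_eq_zero] at hx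
    · right
      rw [mul_zero, mul_eq_zero_iff_right (nonZeroDivisors.ne_zero (hS s'.2))] at hb
      rwa [hb, map_zero, (h.2.1 t).mul_left_eq_zero] at hy
  exact NoZeroDivisors.to_isDomain L

/-- The right Ore condition on the nonzero elements passes to right Ore localizations. -/
theorem IsRightOreLocalization.rightOre {R L : Type*} [Ring R] [IsDomain R]
    (hR : RightOre R (nonZeroDivisors R)) [Ring L] [IsDomain L] {S : Submonoid R}
    {ι : R →+* L} (h : IsRightOreLocalization S ι) : RightOre L (nonZeroDivisors L) := by
  rintro x ⟨y, hy⟩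
  have hy0 := nonZeroDivisors.ne_zero hy
  obtain ⟨a, s, hx⟩ := h.exists_mul_eq x
  obtain ⟨b, t, hb⟩ := h.exists_mul_eq y
  have hb0 : b ≠ 0 := by
    rintro rfl
    rw [map_zero, (h.2.1 t).mul_left_eq_zero] at hb
    exact hy0 hb
  obtain ⟨a', b', hb', hab⟩ := hR.exists_mul_eq_mul a hb0
  refine ⟨ι t * ι a', ⟨ι s * ι b', mem_nonZeroDivisors_of_ne_zero
    (mul_ne_zero (h.2.1 s).ne_zero ((map_ne_zero_iff ι h.1).2 hb'))⟩, ?_⟩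
  change x * (ι s * ι b') = y * (ι t * ι a')
  rw [← mul_assoc, hx, ← mul_assoc, hb, ← map_mul, ← map_mul, hab]

/-- A skew field of fractions of a right Ore localization of `R` is a skew field of fractions
of `R`. -/
theorem IsRightOreLocalization.comp {R L K : Type*} [Ring R] [IsDomain R]
    (hR : RightOre R (nonZeroDivisors R)) [Ring L] [IsDomain L] [DivisionRing K]
    {S : Submonoid R} (hS : S ≤ nonZeroDivisors R) {ι : R →+* L} {ιL : L →+* K}
    (h : IsRightOreLocalization S ι) (hK : IsRightOreLocalization (nonZeroDivisors L) ιL) :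
    IsRightOreLocalization (nonZeroDivisors R) (ιL.comp ι) := by
  refine .of_exists_mul_eq (hK.1.comp h.1) fun z => ?_
  obtain ⟨x, ⟨y, hy⟩, hz⟩ := hK.exists_mul_eq z
  obtain ⟨a, s, hx⟩ := h.exists_mul_eq x
  obtain ⟨b, t, hb⟩ := h.exists_mul_eq y
  have hb0 : b ≠ 0 := by
    rintro rfl
    rw [map_zero, (h.2.1 t).mul_left_eq_zero] at hb
    exact nonZeroDivisors.ne_zero hy hb
  obtain ⟨r, e, he, hte⟩ := hR.exists_mul_eq_mul (t : R) (nonZeroDivisors.ne_zero (hS s.2))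
  refine ⟨a * r, b * e, mul_ne_zero hb0 he, ?_⟩
  have hye : ι (b * e) = y * (ι s * ι r) := by
    rw [map_mul, ← hb, mul_assoc, ← map_mul, hte, map_mul]
  rw [RingHom.comp_apply, RingHom.comp_apply, hye, map_mul ιL, ← mul_assoc, hz, ← map_mul,
    ← mul_assoc, hx, ← map_mul]

/-- Embeddings of a right Ore domain into division rings extend to its skew field of
fractions. -/
theorem IsRightOreLocalization.exists_lift {R K K' : Type*} [Ring R] [IsDomain R]
    (hR : RightOre R (nonZeroDivisors R)) [DivisionRing K] [DivisionRing K'] {ι : R →+* K}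
    (h : IsRightOreLocalization (nonZeroDivisors R) ι) {ι' : R →+* K'}
    (hι' : Function.Injective ι') : ∃ f : K →+* K', ∀ a, f (ι a) = ι' a := by
  have hne {s : R} (hs : s ≠ 0) : ι' s ≠ 0 := (map_ne_zero_iff ι' hι').2 hs
  have hfrac (x : K) : ∃ n d : R, d ≠ 0 ∧ x * ι d = ι n := by
    obtain ⟨a, s, hx⟩ := h.exists_mul_eq x
    exact ⟨a, s, nonZeroDivisors.ne_zero s.2, hx⟩
  choose n d hd hnd using hfrac
  let f (x : K) : K' := ι' (n x) * (ι' (d x))⁻¹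
  have hfd (x : K) : f x * ι' (d x) = ι' (n x) := inv_mul_cancel_right₀ (hne (hd x)) _
  have hf {x : K} {a s : R} (hs : s ≠ 0) (hx : x * ι s = ι a) : f x * ι' s = ι' a := by
    obtain ⟨r, e, he, hse⟩ := hR.exists_mul_eq_mul s (hd x)
    have hae : a * e = n x * r := by
      apply h.1
      rw [map_mul, ← hx, mul_assoc, ← map_mul, hse, map_mul, ← mul_assoc, hnd, ← map_mul]
    apply mul_right_cancel₀ (hne he)
    rw [mul_assoc, ← map_mul, hse, map_mul, ← mul_assoc, hfd, ← map_mul, ← map_mul, hae]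
  have hfι (a : R) : f (ι a) = ι' a := by
    simpa using hf (x := ι a) (a := a) one_ne_zero (by simp)
  refine ⟨{ toFun := f
            map_one' := by simpa using hfι 1
            map_zero' := by simpa using hfι 0
            map_mul' := fun x y => ?_
            map_add' := fun x y => ?_ }, hfι⟩
  · obtain ⟨r, e, he, hre⟩ := hR.exists_mul_eq_mul (n y) (hd x)
    have hD := mul_ne_zero (hd y) he
    have key : x * y * ι (d y * e) = ι (n x * r) := by
      rw [map_mul, mul_assoc, ← mul_assoc y, hnd, ← map_mul, hre, map_mul, ← mul_assoc, hnd,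
        ← map_mul]
    apply mul_right_cancel₀ (hne hD)
    rw [hf hD key, map_mul ι' (d y), mul_assoc, ← mul_assoc (f y), hfd, ← map_mul ι' (n y), hre,
      map_mul ι' (d x), ← mul_assoc, hfd, ← map_mul]
  · obtain ⟨r, e, he, hre⟩ := hR.exists_mul_eq_mul (d y) (hd x)
    have hD := mul_ne_zero (hd y) he
    have hx : x * ι (d y * e) = ι (n x * r) := by
      rw [hre, map_mul, ← mul_assoc, hnd, ← map_mul]
    have hy : y * ι (d y * e) = ι (n y * e) := by
      rw [map_mul, ← mul_assoc, hnd, ← map_mul]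
    have hxy : (x + y) * ι (d y * e) = ι (n x * r + n y * e) := by
      rw [add_mul, hx, hy, map_add]
    apply mul_right_cancel₀ (hne hD)
    rw [hf hD hxy, add_mul, hf hD hx, hf hD hy, map_add]

/-- The skew field of fractions of a right Ore domain is unique up to isomorphism. -/
theorem IsRightOreLocalization.nonempty_ringEquiv {R K K' : Type*} [Ring R] [IsDomain R]
    (hR : RightOre R (nonZeroDivisors R)) [DivisionRing K] [DivisionRing K'] {ι : R →+* K}
    {ι' : R →+* K'} (h : IsRightOreLocalization (nonZeroDivisors R) ι)
    (h' : IsRightOreLocalization (nonZeroDivisors R) ι') : Nonempty (K ≃+* K') := by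
  obtain ⟨f, hf⟩ := h.exists_lift hR h'.1
  refine ⟨RingEquiv.ofBijective f ⟨f.injective, fun y => ?_⟩⟩
  obtain ⟨a, s, hy⟩ := h'.exists_mul_eq y
  have hs : ι' s ≠ 0 := (h'.2.1 s).ne_zero
  refine ⟨ι a * (ι s)⁻¹, ?_⟩
  rw [map_mul, map_inv₀, hf, hf, ← hy, mul_inv_cancel_right₀ hs]

/-- **Localizations of an Ore domain have the same skew field of fractions.**
Let `R` be a (not necessarily commutative) domain such that the set `R \ {0}` of nonzero
elements (equivalently, the nonzerodivisors of `R`) satisfies the right Ore condition, so that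
the skew field of fractions `Frac R` exists; let `F` be such a skew field of fractions.  Let
`S` be a submonoid of `R \ {0}` satisfying the right Ore condition, and let `L` (an Ore
localization `R_S`) be a right Ore localization of `R` at `S`.  Then `L` is again a domain
whose nonzero elements satisfy the right Ore condition, and every skew field of fractions `F'`
of `L` is isomorphic as a ring to `Frac R`: `Frac (R_S) ≅ Frac R`. -/
theorem oreLocalization_fractions
    (R : Type*) [Ring R] [IsDomain R]
    (hR : RightOre R (nonZeroDivisors R))
    (S : Submonoid R) (hS : S ≤ nonZeroDivisors R) (hSOre : RightOre R S)
    (L : Type*) [Ring L] (ι : R →+* L) (hL : IsRightOreLocalization S ι)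
    (F : Type*) [DivisionRing F] (ιF : R →+* F)
    (hF : IsRightOreLocalization (nonZeroDivisors R) ιF) :
    IsDomain L ∧ RightOre L (nonZeroDivisors L) ∧
      ∀ (F' : Type*) [DivisionRing F'] (ιL : L →+* F'),
        IsRightOreLocalization (nonZeroDivisors L) ιL → Nonempty (F' ≃+* F) := by
  have : IsDomain L := hL.isDomain hS hSOre
  exact ⟨this, hL.rightOre hR, fun F' _ ιL hF' =>
    (hL.comp hR hS hF').nonempty_ringEquiv hR hF⟩
end
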